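/- For every point w ∈ ℂP¹, the point p = ((1:0), (1:0), w) of ℂP¹ × ℂP¹ × ℂP¹ lies in the closure of F, and the map φ (defined on F) tends to the constant point ((1:1), (1:1), (1:1)) along the filter of neighborhoods of p within F (nhdsWithin p F). (The homeomorphism f₁₂,₁₃ extends continuously to the boundary set F̄^{1'2'} = {((1:0),(1:0),w) : w ∈ ℂP¹} by the constant map with value ((1:1),(1:1),(1:1)).) -/

import Mathlib

open scoped LinearAlgebra.Projectivization

/-- The quotient topology on the complex projective line. -/
noncomputable instance : TopologicalSpace (ℙ ℂ (Fin 2 → ℂ)) := instTopologicalSpaceQuotient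

/-- The point of the complex projective line with homogeneous coordinates `(a : b)`. -/
noncomputable def pt (a b : ℂ) (h : a ≠ 0 ∨ b ≠ 0) : ℙ ℂ (Fin 2 → ℂ) :=
  Projectivization.mk ℂ ![a, b] (fun hz => by
    rcases h with h | h
    · exact h (by simpa using congrFun hz 0)
    · exact h (by simpa using congrFun hz 1))

/-- The point `(a : b)` of `ℂP¹` for possibly degenerate data (junk value `(1:0)` if
`a = b = 0`). -/
noncomputable def pt' (a b : ℂ) : ℙ ℂ (Fin 2 → ℂ) :=
  if h : a ≠ 0 ∨ b ≠ 0 then pt a b h else pt 1 0 (Or.inl one_ne_zero)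

/-- The space of parameters `F` of the main stratum of `G_{5,2}`, as a subset of
`ℂP¹ × ℂP¹ × ℂP¹`: triples `((c₁:c₁'), (c₂:c₂'), (c₃:c₃'))` with `c₁c₂'c₃ = c₁'c₂c₃'` and
`cᵢ, cᵢ' ≠ 0`, `cᵢ ≠ cᵢ'`. -/
def Fset : Set (ℙ ℂ (Fin 2 → ℂ) × ℙ ℂ (Fin 2 → ℂ) × ℙ ℂ (Fin 2 → ℂ)) :=
  {p | ∃ (c₁ c₁' c₂ c₂' c₃ c₃' : ℂ) (h₁ : c₁ ≠ 0) (h₂ : c₂ ≠ 0) (h₃ : c₃ ≠ 0),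
    c₁' ≠ 0 ∧ c₂' ≠ 0 ∧ c₃' ≠ 0 ∧ c₁ ≠ c₁' ∧ c₂ ≠ c₂' ∧ c₃ ≠ c₃' ∧
    c₁ * c₂' * c₃ = c₁' * c₂ * c₃' ∧
    p = (pt c₁ c₁' (Or.inl h₁), pt c₂ c₂' (Or.inl h₂), pt c₃ c₃' (Or.inl h₃))}

/-- The transition map `φ = f₁₂,₁₃`,
`((c₁:c₁'), (c₂:c₂'), (c₃:c₃')) ↦ ((c₁ : c₁-c₁'), (c₂ : c₂-c₂'), ((c₁-c₁')c₂'c₃ : c₁'(c₂-c₂')c₃'))`,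
written in terms of chosen homogeneous representatives; its restriction to the space of
parameters `F` (where the formula is independent of the chosen representatives) is the
transition homeomorphism between the charts `M₁₂` and `M₁₃` of `G_{5,2}`. -/
noncomputable def phiFun (p : ℙ ℂ (Fin 2 → ℂ) × ℙ ℂ (Fin 2 → ℂ) × ℙ ℂ (Fin 2 → ℂ)) :
    ℙ ℂ (Fin 2 → ℂ) × ℙ ℂ (Fin 2 → ℂ) × ℙ ℂ (Fin 2 → ℂ) :=
  (pt' (p.1.rep 0) (p.1.rep 0 - p.1.rep 1),
   pt' (p.2.1.rep 0) (p.2.1.rep 0 - p.2.1.rep 1),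
   pt' ((p.1.rep 0 - p.1.rep 1) * p.2.1.rep 1 * p.2.2.rep 0)
       (p.1.rep 1 * (p.2.1.rep 0 - p.2.1.rep 1) * p.2.2.rep 1))

open Filter Topology

lemma pt_eq_pt {a b c d : ℂ} (h : a ≠ 0 ∨ b ≠ 0) (h' : c ≠ 0 ∨ d ≠ 0) (e : ℂ)
    (h1 : e * c = a) (h2 : e * d = b) : pt a b h = pt c d h' := by
  unfold pt
  rw [Projectivization.mk_eq_mk_iff']
  refine ⟨e, ?_⟩
  ext i
  fin_cases i
  · simpa using h1
  · simpa using h2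

lemma pt'_eq {a b : ℂ} (ha : a ≠ 0) : pt' a b = pt 1 (b / a) (Or.inl one_ne_zero) := by
  unfold pt'
  rw [dif_pos (Or.inl ha)]
  exact pt_eq_pt _ _ a (by ring) (by field_simp)

lemma cont_Q : Continuous (fun t : ℂ => pt 1 t (Or.inl one_ne_zero)) := by
  have h : Continuous (fun t : ℂ => (⟨![1, t], fun hz => one_ne_zero (congrFun hz 0)⟩ :
      {v : Fin 2 → ℂ // v ≠ 0})) := by
    refine Continuous.subtype_mk ?_ _
    refine continuous_pi fun i => ?_
    fin_cases i
    · exact continuous_const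
    · exact continuous_id
  exact continuous_quotient_mk'.comp h

lemma cont_R : Continuous (fun t : ℂ => pt t 1 (Or.inr one_ne_zero)) := by
  have h : Continuous (fun t : ℂ => (⟨![t, 1], fun hz => one_ne_zero (congrFun hz 1)⟩ :
      {v : Fin 2 → ℂ // v ≠ 0})) := by
    refine Continuous.subtype_mk ?_ _
    refine continuous_pi fun i => ?_
    fin_cases i
    · exact continuous_id
    · exact continuous_const
  exact continuous_quotient_mk'.comp h

lemma rep_pt (a b : ℂ) (h : a ≠ 0 ∨ b ≠ 0) :
    ∃ e : ℂ, e ≠ 0 ∧ (pt a b h).rep 0 = e * a ∧ (pt a b h).rep 1 = e * b := by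
  obtain ⟨u, hu⟩ := Projectivization.exists_smul_eq_mk_rep ℂ ![a, b] (fun hz => by
    rcases h with h | h
    · exact h (by simpa using congrFun hz 0)
    · exact h (by simpa using congrFun hz 1))
  refine ⟨u, u.ne_zero, ?_, ?_⟩
  · unfold pt
    rw [← hu]; simp [Units.smul_def]
  · unfold pt
    rw [← hu]; simp [Units.smul_def]

noncomputable def slo (p : ℙ ℂ (Fin 2 → ℂ)) : ℂ := p.rep 1 / p.rep 0

lemma slo_pt {a b : ℂ} (h : a ≠ 0) : slo (pt a b (Or.inl h)) = b / a := by
  obtain ⟨e, he, h0, h1⟩ := rep_pt a b (Or.inl h)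
  unfold slo
  rw [h0, h1]
  field_simp

lemma isOpen_cone (ε : ℝ) : IsOpen {p : ℙ ℂ (Fin 2 → ℂ) | ‖p.rep 1‖ < ε * ‖p.rep 0‖} := by
  refine isQuotientMap_quotient_mk'.isOpen_preimage.1 ?_
  have : IsOpen {v : {v : Fin 2 → ℂ // v ≠ 0} | ‖v.1 1‖ < ε * ‖v.1 0‖} := by
    have hc : ∀ i : Fin 2, Continuous fun v : {v : Fin 2 → ℂ // v ≠ 0} => v.1 i :=
      fun i => (continuous_apply i).comp continuous_subtype_val
    exact isOpen_lt (hc 1).norm (continuous_const.mul (hc 0).norm)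
  convert this using 1
  ext ⟨v, hv⟩
  obtain ⟨u, hu⟩ := Projectivization.exists_smul_eq_mk_rep ℂ v hv
  change ‖(Projectivization.mk ℂ v hv).rep 1‖ < ε * ‖(Projectivization.mk ℂ v hv).rep 0‖ ↔
    ‖v 1‖ < ε * ‖v 0‖
  rw [← hu]
  have : 0 < ‖(u : ℂ)‖ := norm_pos_iff.2 u.ne_zero
  simp only [Units.smul_def, Pi.smul_apply, smul_eq_mul, norm_mul]
  rw [mul_left_comm, mul_lt_mul_iff_right₀ this]

lemma slo_tendsto : Tendsto slo (𝓝 (pt 1 0 (Or.inl one_ne_zero))) (𝓝 0) := by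
  rw [Metric.tendsto_nhds]
  intro ε hε
  have hm : {p : ℙ ℂ (Fin 2 → ℂ) | ‖p.rep 1‖ < ε * ‖p.rep 0‖} ∈
      𝓝 (pt 1 0 (Or.inl one_ne_zero)) := by
    refine (isOpen_cone ε).mem_nhds ?_
    obtain ⟨e, he, h0, h1⟩ := rep_pt 1 0 (Or.inl one_ne_zero)
    simp only [Set.mem_ofPred_eq, h0, h1]
    simp [hε, he]
  filter_upwards [hm] with p hp
  have h0 : 0 < ‖p.rep 0‖ := by
    have := (norm_nonneg _).trans_lt hp
    exact pos_of_mul_pos_right this hε.le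
  simp only [slo, dist_zero_right, norm_div]
  rwa [div_lt_iff₀ h0]

lemma phi_eq {p : ℙ ℂ (Fin 2 → ℂ) × ℙ ℂ (Fin 2 → ℂ) × ℙ ℂ (Fin 2 → ℂ)} (hp : p ∈ Fset) :
    phiFun p = (pt 1 (1 - slo p.1) (Or.inl one_ne_zero),
      pt 1 (1 - slo p.2.1) (Or.inl one_ne_zero),
      pt 1 ((1 - slo p.2.1) / (1 - slo p.1)) (Or.inl one_ne_zero)) := by
  obtain ⟨a, a', b, b', c, c', ha, hb, hc, ha', hb', hc', hna, hnb, hnc, h, rfl⟩ := hp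
  obtain ⟨e, he, e0, e1⟩ := rep_pt a a' (Or.inl ha)
  obtain ⟨f, hf, f0, f1⟩ := rep_pt b b' (Or.inl hb)
  obtain ⟨g, hg, g0, g1⟩ := rep_pt c c' (Or.inl hc)
  have hs : a - a' ≠ 0 := sub_ne_zero.2 hna
  simp only [phiFun, e0, e1, f0, f1, g0, g1, slo_pt ha, slo_pt hb]
  rw [← mul_sub, ← mul_sub, pt'_eq (mul_ne_zero he ha), pt'_eq (mul_ne_zero hf hb),
    pt'_eq (mul_ne_zero (mul_ne_zero (mul_ne_zero he hs) (mul_ne_zero hf hb'))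
      (mul_ne_zero hg hc))]
  refine Prod.ext ?_ (Prod.ext ?_ ?_) <;> dsimp only <;> congr 1
  · field_simp
  · field_simp
  · have h2 : 1 - a' / a ≠ 0 := by
      rw [one_sub_div ha]; exact div_ne_zero hs ha
    rw [div_eq_div_iff (mul_ne_zero (mul_ne_zero (mul_ne_zero he hs) (mul_ne_zero hf hb'))
      (mul_ne_zero hg hc)) h2]
    field_simp
    linear_combination (-1 : ℂ) * h

lemma ev_ne (c : ℂ) : ∀ᶠ t in 𝓝[≠] (0 : ℂ), t ≠ c := by
  by_cases h : c = 0
  · subst h; exact self_mem_nhdsWithin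
  · exact nhdsWithin_le_nhds (isOpen_ne.mem_nhds (Ne.symm h))

lemma ev_ne' (g : ℂ → ℂ) (hg : Continuous g) (h0 : g 0 = 0) :
    ∀ᶠ t in 𝓝[≠] (0 : ℂ), g t ≠ 1 :=
  nhdsWithin_le_nhds ((isOpen_ne.preimage hg).mem_nhds (by simp [h0]))

lemma tend_of {g : ℂ → ℙ ℂ (Fin 2 → ℂ)} (hg : Continuous g) {y} (hy : g 0 = y) :
    Tendsto g (𝓝[≠] (0 : ℂ)) (𝓝 y) := by
  rw [← hy]; exact hg.continuousAt.tendsto.mono_left nhdsWithin_le_nhds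

lemma mem_clos (w : ℙ ℂ (Fin 2 → ℂ)) :
    (pt 1 0 (Or.inl one_ne_zero), pt 1 0 (Or.inl one_ne_zero), w) ∈ closure Fset := by
  have hw : (∃ b, w = pt 1 b (Or.inl one_ne_zero)) ∨ w = pt 0 1 (Or.inr one_ne_zero) := by
    induction w using Projectivization.ind with
    | h v hv =>
    have hv2 : v 0 ≠ 0 ∨ v 1 ≠ 0 := by
      by_contra! hh
      exact hv (by ext i; fin_cases i <;> simp [hh])
    have : Projectivization.mk ℂ v hv = pt (v 0) (v 1) hv2 := by
      unfold pt; congr 1; ext i; fin_cases i <;> rfl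
    rw [this]
    by_cases h : v 0 = 0
    · right
      exact pt_eq_pt _ _ (v 1) (by simp [h]) (by simp)
    · left
      exact ⟨v 1 / v 0, pt_eq_pt _ _ (v 0) (by simp) (by field_simp)⟩
  rcases hw with ⟨b, rfl⟩ | rfl
  · refine mem_closure_of_tendsto (b := 𝓝[≠] (0 : ℂ)) (f := fun t => (pt 1 t (Or.inl one_ne_zero),
      pt 1 (t * (b + t)) (Or.inl one_ne_zero), pt 1 (b + t) (Or.inl one_ne_zero))) ?_ ?_
    · refine (tend_of cont_Q rfl).prodMk_nhds (Tendsto.prodMk_nhds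
        (tend_of (cont_Q.comp (by fun_prop : Continuous fun t : ℂ => t * (b + t))) (by simp))
        (tend_of (cont_Q.comp (by fun_prop : Continuous fun t : ℂ => b + t)) (by simp)))
    · filter_upwards [ev_ne 0, ev_ne 1, ev_ne (-b), ev_ne (1 - b),
        ev_ne' (fun t => t * (b + t)) (by fun_prop) (by simp)] with t h0 h1 h2 h3 h4
      have hbt : b + t ≠ 0 := fun h => h2 (by linear_combination h)
      exact ⟨1, t, 1, t * (b + t), 1, b + t, one_ne_zero, one_ne_zero, one_ne_zero, h0,
        mul_ne_zero h0 hbt, hbt, h1.symm, h4.symm, fun h => h3 (by linear_combination -h),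
        by ring, rfl⟩
  · refine mem_closure_of_tendsto (b := 𝓝[≠] (0 : ℂ)) (f := fun t =>
      (pt 1 (t ^ 2) (Or.inl one_ne_zero),
      pt 1 t (Or.inl one_ne_zero), pt t 1 (Or.inr one_ne_zero))) ?_ ?_
    · refine (tend_of (cont_Q.comp (by fun_prop : Continuous fun t : ℂ => t ^ 2))
        (by simp)).prodMk_nhds (Tendsto.prodMk_nhds (tend_of cont_Q rfl) (tend_of cont_R rfl))
    · filter_upwards [ev_ne 0, ev_ne 1,
        ev_ne' (fun t => t ^ 2) (by fun_prop) (by simp)] with t h0 h1 h4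
      exact ⟨1, t ^ 2, 1, t, t, 1, one_ne_zero, one_ne_zero, h0, pow_ne_zero _ h0, h0,
        one_ne_zero, h4.symm, h1.symm, h1, by ring, rfl⟩

/-- For every `w ∈ ℂP¹`, the point `p = ((1:0), (1:0), w)` lies in the closure of the space of
parameters `F` of the main stratum of `G_{5,2}`, and the transition map `φ = f₁₂,₁₃` tends to
the constant value `((1:1), (1:1), (1:1))` along the neighborhoods of `p` within `F`. -/
theorem transition_constant_on_boundary_piece (w : ℙ ℂ (Fin 2 → ℂ)) :
    (pt 1 0 (Or.inl one_ne_zero), pt 1 0 (Or.inl one_ne_zero), w) ∈ closure Fset ∧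
    Filter.Tendsto phiFun
      (nhdsWithin (pt 1 0 (Or.inl one_ne_zero), pt 1 0 (Or.inl one_ne_zero), w) Fset)
      (nhds (pt 1 1 (Or.inl one_ne_zero), pt 1 1 (Or.inl one_ne_zero),
        pt 1 1 (Or.inl one_ne_zero))) := by
  refine ⟨mem_clos w, ?_⟩
  refine Tendsto.congr' (f₁ := fun p => (pt 1 (1 - slo p.1) (Or.inl one_ne_zero),
      pt 1 (1 - slo p.2.1) (Or.inl one_ne_zero),
      pt 1 ((1 - slo p.2.1) / (1 - slo p.1)) (Or.inl one_ne_zero))) ?_ ?_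
  · filter_upwards [self_mem_nhdsWithin] with p hp using (phi_eq hp).symm
  · refine Tendsto.mono_left ?_ nhdsWithin_le_nhds
    have hx : Tendsto (fun p : ℙ ℂ (Fin 2 → ℂ) × ℙ ℂ (Fin 2 → ℂ) × ℙ ℂ (Fin 2 → ℂ) =>
        1 - slo p.1) (𝓝 (pt 1 0 (Or.inl one_ne_zero), pt 1 0 (Or.inl one_ne_zero), w)) (𝓝 1) := by
      have := slo_tendsto.comp (continuous_fst.tendsto
        ((pt 1 0 (Or.inl one_ne_zero), pt 1 0 (Or.inl one_ne_zero), w) :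
          ℙ ℂ (Fin 2 → ℂ) × ℙ ℂ (Fin 2 → ℂ) × ℙ ℂ (Fin 2 → ℂ)))
      simpa using tendsto_const_nhds.sub this (a := (1 : ℂ))
    have hy : Tendsto (fun p : ℙ ℂ (Fin 2 → ℂ) × ℙ ℂ (Fin 2 → ℂ) × ℙ ℂ (Fin 2 → ℂ) =>
        1 - slo p.2.1) (𝓝 (pt 1 0 (Or.inl one_ne_zero), pt 1 0 (Or.inl one_ne_zero), w)) (𝓝 1) := by
      have := slo_tendsto.comp ((continuous_fst.comp continuous_snd).tendsto
        ((pt 1 0 (Or.inl one_ne_zero), pt 1 0 (Or.inl one_ne_zero), w) :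
          ℙ ℂ (Fin 2 → ℂ) × ℙ ℂ (Fin 2 → ℂ) × ℙ ℂ (Fin 2 → ℂ)))
      simpa using tendsto_const_nhds.sub this (a := (1 : ℂ))
    have hz := hy.div hx one_ne_zero
    rw [div_one] at hz
    exact ((cont_Q.tendsto 1).comp hx).prodMk_nhds
      (((cont_Q.tendsto 1).comp hy).prodMk_nhds ((cont_Q.tendsto 1).comp hz))
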